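/- Let S₀, S₁ and R₂ denote the images in PSL₂(ℤ) of the matrices S, T³ST⁻³ and T²ST⁻¹ respectively (so S₀ and S₁ have order 2 and R₂ has order 3 in PSL₂(ℤ)). Then the group homomorphism from the free product C₂ * C₂ * C₃ to PSL₂(ℤ) sending the two generators of order 2 to S₀ and S₁ and the generator of order 3 to R₂ is injective, and its image is a subgroup of PSL₂(ℤ) of index 4. -/

import Mathlib

noncomputable section

/-- `SL₂(ℤ)`. -/
abbrev SL2Z : Type := Matrix.SpecialLinearGroup (Fin 2) ℤ

/-- `PSL₂(ℤ) = SL₂(ℤ)/{±I}`, the quotient of `SL₂(ℤ)` by its center. -/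
abbrev PSL2Z : Type := SL2Z ⧸ Subgroup.center SL2Z

/-- The projection `SL₂(ℤ) → PSL₂(ℤ)`. -/
def pmk : SL2Z →* PSL2Z := QuotientGroup.mk' (Subgroup.center SL2Z)

/-- `S₀`, the image in `PSL₂(ℤ)` of `S`. -/
def S₀ : PSL2Z := pmk ModularGroup.S

/-- `S₁`, the image in `PSL₂(ℤ)` of `T³ST⁻³`. -/
def S₁ : PSL2Z :=
  pmk (ModularGroup.T ^ 3 * ModularGroup.S * (ModularGroup.T ^ 3)⁻¹)

/-- `R₂`, the image in `PSL₂(ℤ)` of `T²ST⁻¹`. -/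
def R₂ : PSL2Z :=
  pmk (ModularGroup.T ^ 2 * ModularGroup.S * ModularGroup.T⁻¹)

/-- `C₂ * C₂ * C₃`, the free product of two cyclic groups of order 2 and one cyclic group
of order 3. -/
abbrev C2C2C3 : Type := Monoid.CoprodI (fun i : Fin 3 => Multiplicative (ZMod (![2, 2, 3] i)))

/-- The three generators of `C₂ * C₂ * C₃`, one for each free factor. -/
def genC2C2C3 (i : Fin 3) : C2C2C3 :=
  Monoid.CoprodI.of (i := i) (Multiplicative.ofAdd (1 : ZMod (![2, 2, 3] i)))

theorem fpe_pmk_eq_one {A : SL2Z} : pmk A = 1 ↔ A = 1 ∨ A = -1 := by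
  have h0 : pmk A = 1 ↔ A ∈ Subgroup.center SL2Z := by
    unfold pmk
    rw [QuotientGroup.mk'_apply]
    exact QuotientGroup.eq_one_iff A
  rw [h0, Matrix.SpecialLinearGroup.mem_center_iff]
  constructor
  · rintro ⟨r, hr, h⟩
    have hr' : r ^ 2 = 1 := by simpa using hr
    rcases (show r = 1 ∨ r = -1 by simpa using hr') with rfl | rfl
    · left; ext i j; rw [← h]; fin_cases i <;> fin_cases j <;> simp
    · right; ext i j; rw [← h]; fin_cases i <;> fin_cases j <;> simp
  · rintro (rfl | rfl)
    · exact ⟨1, by simp, by simp⟩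
    · refine ⟨-1, by simp, ?_⟩
      ext i j; fin_cases i <;> fin_cases j <;> simp

theorem fpe_pmk_eq {A B : SL2Z} : pmk A = pmk B ↔ A = B ∨ A = -B := by
  have : pmk A = pmk B ↔ pmk (A * B⁻¹) = 1 := by
    rw [map_mul, map_inv, mul_inv_eq_one]
  rw [this, fpe_pmk_eq_one, mul_inv_eq_one, mul_inv_eq_iff_eq_mul, neg_one_mul]

theorem fpe_surj (g : PSL2Z) : ∃ A, pmk A = g := QuotientGroup.mk'_surjective _ g

/-- a set of classes cut out by a predicate on entries -/
def fpeX (p : ℤ → ℤ → ℤ → ℤ → Prop) : Set PSL2Z :=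
  {g | ∃ A : SL2Z, pmk A = g ∧ p (A 0 0) (A 0 1) (A 1 0) (A 1 1)}

theorem fpe_mem {p : ℤ → ℤ → ℤ → ℤ → Prop} (hp : ∀ a b c d, p a b c d → p (-a) (-b) (-c) (-d))
    (A : SL2Z) : pmk A ∈ fpeX p ↔ p (A 0 0) (A 0 1) (A 1 0) (A 1 1) := by
  constructor
  · rintro ⟨B, hB, h⟩
    rcases fpe_pmk_eq.1 hB with rfl | rfl
    · exact h
    · simpa using hp _ _ _ _ h
  · intro h; exact ⟨A, rfl, h⟩

theorem fpe_S0_eq : ((ModularGroup.S : SL2Z) : Matrix (Fin 2) (Fin 2) ℤ) = !![0, -1; 1, 0] := rfl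

theorem fpe_S1_eq : ((ModularGroup.T ^ 3 * ModularGroup.S * (ModularGroup.T ^ 3)⁻¹ : SL2Z) :
    Matrix (Fin 2) (Fin 2) ℤ) = !![3, -10; 1, -3] := by
  decide

theorem fpe_R2_eq : ((ModularGroup.T ^ 2 * ModularGroup.S * ModularGroup.T⁻¹ : SL2Z) :
    Matrix (Fin 2) (Fin 2) ℤ) = !![2, -3; 1, -1] := by
  decide

theorem fpe_step {p q : ℤ → ℤ → ℤ → ℤ → Prop} (M : SL2Z) {x y z w : ℤ}
    (hM : (M : Matrix (Fin 2) (Fin 2) ℤ) = !![x, y; z, w])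
    (h : ∀ a b c d, p a b c d → q (x*a+y*c) (x*b+y*d) (z*a+w*c) (z*b+w*d)) {g : PSL2Z}
    (hg : g ∈ fpeX p) : pmk M * g ∈ fpeX q := by
  obtain ⟨A, rfl, hA⟩ := hg
  refine ⟨M * A, by simp, ?_⟩
  have := h _ _ _ _ hA
  simpa [hM, Matrix.mul_apply, Fin.sum_univ_two] using this

theorem fpe_S0_sq : S₀ ^ 2 = 1 := by
  unfold S₀; rw [← map_pow, fpe_pmk_eq_one]; decide
theorem fpe_S1_sq : S₁ ^ 2 = 1 := by
  unfold S₁; rw [← map_pow, fpe_pmk_eq_one]; decide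
theorem fpe_R2_cube : R₂ ^ 3 = 1 := by
  unfold R₂; rw [← map_pow, fpe_pmk_eq_one]; decide
theorem fpe_S0_ne : S₀ ≠ 1 := by
  unfold S₀; rw [Ne, fpe_pmk_eq_one]; decide
theorem fpe_S1_ne : S₁ ≠ 1 := by
  unfold S₁; rw [Ne, fpe_pmk_eq_one]; decide
theorem fpe_R2_ne : R₂ ≠ 1 := by
  unfold R₂; rw [Ne, fpe_pmk_eq_one]; decide

/-- ping-pong predicates -/
def fpeP : Fin 3 → ℤ → ℤ → ℤ → ℤ → Prop :=
  ![fun a _ c _ => a * c < 0, fun a _ c _ => 3 * (c * c) < a * c,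
    fun a _ c _ => 0 < a * c ∧ a * c < 3 * (c * c)]

theorem fpeP_neg (i) : ∀ a b c d, fpeP i a b c d → fpeP i (-a) (-b) (-c) (-d) := by
  intro a b c d; fin_cases i <;> simp [fpeP]

theorem fpe_pp0 (j : Fin 3) (hj : j ≠ 0) {g} (hg : g ∈ fpeX (fpeP j)) :
    S₀ * g ∈ fpeX (fpeP 0) := by
  refine fpe_step _ fpe_S0_eq ?_ hg
  intro a b c d
  fin_cases j
  · simp at hj
  · simp [fpeP]; intro h; nlinarith [mul_self_nonneg c]
  · simp [fpeP]; intro h _; linarith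

theorem fpe_pp1 (j : Fin 3) (hj : j ≠ 1) {g} (hg : g ∈ fpeX (fpeP j)) :
    S₁ * g ∈ fpeX (fpeP 1) := by
  refine fpe_step _ fpe_S1_eq ?_ hg
  intro a b c d
  fin_cases j
  · simp [fpeP]; intro h; nlinarith [mul_self_nonneg c]
  · simp at hj
  · simp [fpeP]; intro h _; nlinarith

theorem fpe_pp2 (j : Fin 3) (hj : j ≠ 2) {g} (hg : g ∈ fpeX (fpeP j)) :
    R₂ * g ∈ fpeX (fpeP 2) := by
  refine fpe_step _ fpe_R2_eq ?_ hg
  intro a b c d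
  fin_cases j
  · simp [fpeP]; intro h
    constructor <;> nlinarith [mul_self_nonneg c, mul_self_nonneg a]
  · simp [fpeP]; intro h
    constructor <;> nlinarith [mul_self_nonneg c, mul_self_nonneg a, mul_self_nonneg (a - 3*c), mul_self_nonneg (a - 2*c)]
  · simp at hj

theorem fpe_R2sq_eq : (((ModularGroup.T ^ 2 * ModularGroup.S * ModularGroup.T⁻¹)^2 : SL2Z) :
    Matrix (Fin 2) (Fin 2) ℤ) = !![1, -3; 1, -2] := by
  decide

theorem fpe_pp3 (j : Fin 3) (hj : j ≠ 2) {g} (hg : g ∈ fpeX (fpeP j)) :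
    R₂ ^ 2 * g ∈ fpeX (fpeP 2) := by
  unfold R₂
  rw [← map_pow]
  refine fpe_step _ fpe_R2sq_eq ?_ hg
  intro a b c d
  fin_cases j
  · simp [fpeP]; intro h
    constructor <;> nlinarith [mul_self_nonneg c, mul_self_nonneg a]
  · simp [fpeP]; intro h
    constructor <;> nlinarith [mul_self_nonneg c, mul_self_nonneg a, mul_self_nonneg (a - 3*c), mul_self_nonneg (a - 2*c)]
  · simp at hj

theorem fpe_disj {i j : Fin 3} (hij : i ≠ j) : Disjoint (fpeX (fpeP i)) (fpeX (fpeP j)) := by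
  rw [Set.disjoint_left]
  intro g hi hj
  obtain ⟨A, rfl⟩ := fpe_surj g
  rw [fpe_mem (fpeP_neg _)] at hi hj
  generalize A 0 0 = a at *
  generalize A 1 0 = c at *
  fin_cases i <;> fin_cases j <;> simp [fpeP] at hi hj hij <;> nlinarith [mul_self_nonneg c]

theorem fpe_nonempty (i : Fin 3) : (fpeX (fpeP i)).Nonempty := by
  fin_cases i
  · exact ⟨_, ⟨⟨!![-1, 0; 1, -1], by simp [Matrix.det_fin_two]⟩, rfl, by simp [fpeP]⟩⟩
  · exact ⟨_, ⟨⟨!![4, -1; 1, 0], by simp [Matrix.det_fin_two]⟩, rfl, by simp [fpeP]⟩⟩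
  · exact ⟨_, ⟨⟨!![1, 0; 1, 1], by simp [Matrix.det_fin_two]⟩, rfl, by simp [fpeP]⟩⟩

theorem fpe_elts (f : C2C2C3 →* PSL2Z) 
    (h0 : f (genC2C2C3 0) = S₀) (h1 : f (genC2C2C3 1) = S₁) (h2 : f (genC2C2C3 2) = R₂)
    (i : Fin 3) (h : Multiplicative (ZMod (![2, 2, 3] i))) :
    h = 1 ∨ (i = 0 ∧ f (Monoid.CoprodI.of h) = S₀) ∨ (i = 1 ∧ f (Monoid.CoprodI.of h) = S₁) ∨
      (i = 2 ∧ (f (Monoid.CoprodI.of h) = R₂ ∨ f (Monoid.CoprodI.of h) = R₂ ^ 2)) := by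
  fin_cases i
  · have : ∀ h : Multiplicative (ZMod 2), h = 1 ∨ h = Multiplicative.ofAdd 1 := by decide
    rcases this h with e | e
    · exact Or.inl e
    · right; left; exact ⟨rfl, by rw [e]; exact h0⟩
  · have : ∀ h : Multiplicative (ZMod 2), h = 1 ∨ h = Multiplicative.ofAdd 1 := by decide
    rcases this h with e | e
    · exact Or.inl e
    · right; right; left; exact ⟨rfl, by rw [e]; exact h1⟩
  · have : ∀ h : Multiplicative (ZMod 3), h = 1 ∨ h = Multiplicative.ofAdd 1 ∨
      h = (Multiplicative.ofAdd 1) ^ 2 := by decide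
    rcases this h with e | e | e
    · exact Or.inl e
    · right; right; right; exact ⟨rfl, Or.inl (by rw [e]; exact h2)⟩
    · right; right; right
      refine ⟨rfl, Or.inr ?_⟩
      rw [← h2, ← map_pow]
      unfold genC2C2C3
      rw [← map_pow]
      exact congrArg (fun x => f (Monoid.CoprodI.of (i := (2 : Fin 3)) x)) e

theorem fpe_inj (f : C2C2C3 →* PSL2Z) 
    (h0 : f (genC2C2C3 0) = S₀) (h1 : f (genC2C2C3 1) = S₁) (h2 : f (genC2C2C3 2) = R₂) :
    Function.Injective f := by
  have key := Monoid.CoprodI.lift_injective_of_ping_pong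
    (fun i : Fin 3 => f.comp (Monoid.CoprodI.of (i := i)))
    (Or.inl (by simp)) (fun i => fpeX (fpeP i)) fpe_nonempty (fun i j hij => fpe_disj hij) ?_
  · rwa [Monoid.CoprodI.lift_comp_of'] at key
  · intro i j hij h hh
    rintro _ ⟨g, hg, rfl⟩
    simp only [MonoidHom.comp_apply, smul_eq_mul]
    rcases fpe_elts f h0 h1 h2 i h with e | ⟨rfl, e⟩ | ⟨rfl, e⟩ | ⟨rfl, e | e⟩
    · exact absurd e hh
    · rw [e]; exact fpe_pp0 j hij.symm hg
    · rw [e]; exact fpe_pp1 j hij.symm hg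
    · rw [e]; exact fpe_pp2 j hij.symm hg
    · rw [e]; exact fpe_pp3 j hij.symm hg

/-- the congruence condition mod 4 -/
def fpeQ4 (a b c d : ZMod 4) : Prop :=
  (a, b, c, d) ∈ [((0 : ZMod 4), (1 : ZMod 4), (3 : ZMod 4), (0 : ZMod 4)), (0, 3, 1, 0),
    (1, 0, 0, 1), (1, 1, 1, 2), (1, 2, 3, 3), (1, 3, 2, 3), (2, 1, 1, 3), (2, 3, 3, 1),
    (3, 0, 0, 3), (3, 1, 2, 1), (3, 2, 1, 1), (3, 3, 3, 2)]

instance (a b c d : ZMod 4) : Decidable (fpeQ4 a b c d) := by unfold fpeQ4; infer_instance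

/-- the congruence condition on integers -/
def fpeQ (a b c d : ℤ) : Prop := fpeQ4 a b c d

theorem fpeQ_neg (a b c d : ℤ) : fpeQ a b c d → fpeQ (-a) (-b) (-c) (-d) := by
  have : ∀ a b c d, fpeQ4 a b c d → fpeQ4 (-a) (-b) (-c) (-d) := by decide
  unfold fpeQ; push_cast; apply this

theorem fpeQ_S0 {g} (hg : g ∈ fpeX fpeQ) : S₀ * g ∈ fpeX fpeQ := by
  refine fpe_step _ fpe_S0_eq ?_ hg
  have : ∀ a b c d, fpeQ4 a b c d → fpeQ4 (0*a+(-1)*c) (0*b+(-1)*d) (1*a+0*c) (1*b+0*d) := by decide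
  intro a b c d; unfold fpeQ; push_cast; apply this

theorem fpeQ_S1 {g} (hg : g ∈ fpeX fpeQ) : S₁ * g ∈ fpeX fpeQ := by
  refine fpe_step _ fpe_S1_eq ?_ hg
  have : ∀ a b c d, fpeQ4 a b c d → fpeQ4 (3*a+(-10)*c) (3*b+(-10)*d) (1*a+(-3)*c) (1*b+(-3)*d) := by
    decide
  intro a b c d; unfold fpeQ; push_cast; apply this

theorem fpeQ_R2 {g} (hg : g ∈ fpeX fpeQ) : R₂ * g ∈ fpeX fpeQ := by
  refine fpe_step _ fpe_R2_eq ?_ hg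
  have : ∀ a b c d, fpeQ4 a b c d → fpeQ4 (2*a+(-3)*c) (2*b+(-3)*d) (1*a+(-1)*c) (1*b+(-1)*d) := by
    decide
  intro a b c d; unfold fpeQ; push_cast; apply this

theorem fpe_range_sub (f : C2C2C3 →* PSL2Z) 
    (h0 : f (genC2C2C3 0) = S₀) (h1 : f (genC2C2C3 1) = S₁) (h2 : f (genC2C2C3 2) = R₂)
    (x : C2C2C3) : f x ∈ fpeX fpeQ := by
  induction x using Monoid.CoprodI.induction_left with
  | one => rw [map_one]; exact ⟨1, by simp, by simp [fpeQ]; decide⟩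
  | @mul i m x ih =>
    rw [map_mul]
    rcases fpe_elts f h0 h1 h2 i m with e | ⟨rfl, e⟩ | ⟨rfl, e⟩ | ⟨rfl, e | e⟩
    · rw [e]; simpa using ih
    · rw [e]; exact fpeQ_S0 ih
    · rw [e]; exact fpeQ_S1 ih
    · rw [e]; exact fpeQ_R2 ih
    · rw [e, sq, mul_assoc]; exact fpeQ_R2 (fpeQ_R2 ih)

/-- image of `T` -/
def fpeT : PSL2Z := pmk ModularGroup.T

theorem fpe_T_notMem (n : ℤ) (h : fpeT ^ n ∈ fpeX fpeQ) : (4 : ℤ) ∣ n := by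
  unfold fpeT at h
  rw [← map_zpow, fpe_mem fpeQ_neg] at h
  rw [ModularGroup.coe_T_zpow] at h
  have : ∀ x : ZMod 4, fpeQ4 1 x 0 1 → x = 0 := by decide
  have := this n (by simpa [fpeQ] using h)
  exact (ZMod.intCast_zmod_eq_zero_iff_dvd n 4).1 this

theorem fpe_T4 : fpeT ^ 4 = S₁ * R₂ * S₀ := by
  unfold fpeT S₁ R₂ S₀; rw [← map_pow, ← map_mul, ← map_mul, fpe_pmk_eq]; decide

theorem fpe_rel0 : S₀ * fpeT ^ (-1 : ℤ) = fpeT ^ (-2 : ℤ) * R₂ := by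
  unfold fpeT R₂ S₀; rw [← map_zpow, ← map_zpow, ← map_mul, ← map_mul, fpe_pmk_eq]; decide
theorem fpe_rel1 : S₀ * fpeT ^ (-2 : ℤ) = fpeT ^ (-1 : ℤ) * R₂ ^ 2 := by
  unfold fpeT R₂ S₀
  rw [← map_zpow, ← map_zpow, ← map_pow, ← map_mul, ← map_mul, fpe_pmk_eq]; decide
theorem fpe_rel2 : S₀ * fpeT ^ (-3 : ℤ) = fpeT ^ (-3 : ℤ) * S₁ := by
  unfold fpeT S₁ S₀; rw [← map_zpow, ← map_mul, ← map_mul, fpe_pmk_eq]; decide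

theorem fpe_gen (g : PSL2Z) : g ∈ Subgroup.closure {S₀, fpeT} := by
  obtain ⟨A, rfl⟩ := fpe_surj g
  have hA : A ∈ Subgroup.closure {ModularGroup.S, ModularGroup.T} := by
    rw [SpecialLinearGroup.SL2Z_generators]; trivial
  have := Subgroup.mem_map_of_mem pmk hA
  rw [MonoidHom.map_closure] at this
  simpa [Set.image_pair, S₀, fpeT] using this

theorem fpe_cover (H : Subgroup PSL2Z) (h0 : S₀ ∈ H) (h1 : S₁ ∈ H) (h2 : R₂ ∈ H) (g : PSL2Z) :
    ∃ n : ℤ, ∃ h ∈ H, g = fpeT ^ n * h := by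
  have hT4 : fpeT ^ (4 : ℤ) ∈ H := by
    have : fpeT ^ (4 : ℤ) = S₁ * R₂ * S₀ := by rw [← fpe_T4]; norm_cast
    rw [this]; exact H.mul_mem (H.mul_mem h1 h2) h0
  have hS : ∀ n : ℤ, ∃ m : ℤ, ∃ h ∈ H, S₀ * fpeT ^ n = fpeT ^ m * h := by
    intro n
    have hn : fpeT ^ n = fpeT ^ (-((-n) % 4)) * (fpeT ^ (4 : ℤ)) ^ (-((-n) / 4)) := by
      rw [← zpow_mul, ← zpow_add]; congr 1; omega
    have hk : (fpeT ^ (4 : ℤ)) ^ (-((-n) / 4)) ∈ H := H.zpow_mem hT4 _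
    rw [hn, ← mul_assoc]
    have hr : (-n) % 4 = 0 ∨ (-n) % 4 = 1 ∨ (-n) % 4 = 2 ∨ (-n) % 4 = 3 := by omega
    rcases hr with e | e | e | e <;> rw [e]
    · exact ⟨0, _, H.mul_mem h0 hk, by simp⟩
    · exact ⟨-2, _, H.mul_mem h2 hk, by rw [fpe_rel0, mul_assoc]⟩
    · exact ⟨-1, _, H.mul_mem (H.pow_mem h2 2) hk, by rw [fpe_rel1, mul_assoc]⟩
    · exact ⟨-3, _, H.mul_mem h1 hk, by rw [fpe_rel2, mul_assoc]⟩
  have hSi : S₀⁻¹ = S₀ := by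
    rw [inv_eq_iff_mul_eq_one, ← sq, fpe_S0_sq]
  have hS' : ∀ y, (∃ n : ℤ, ∃ h ∈ H, y = fpeT ^ n * h) →
      ∃ n : ℤ, ∃ h ∈ H, S₀ * y = fpeT ^ n * h := by
    rintro y ⟨n, h, hh, rfl⟩
    obtain ⟨m, h', hh', e⟩ := hS n
    exact ⟨m, _, H.mul_mem hh' hh, by rw [← mul_assoc, e, mul_assoc]⟩
  have hg := fpe_gen g
  induction hg using Subgroup.closure_induction_left with
  | one => exact ⟨0, 1, H.one_mem, by simp⟩
  | mul_left x hx y _ ih =>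
    rcases hx with rfl | rfl
    · exact hS' y ih
    · obtain ⟨n, h, hh, rfl⟩ := ih
      exact ⟨1 + n, h, hh, by rw [zpow_add, zpow_one, mul_assoc]⟩
  | inv_mul_cancel x hx y _ ih =>
    rcases hx with rfl | rfl
    · rw [hSi]; exact hS' y ih
    · obtain ⟨n, h, hh, rfl⟩ := ih
      exact ⟨-1 + n, h, hh, by rw [zpow_add, zpow_neg_one, mul_assoc]⟩

theorem fpe_index (f : C2C2C3 →* PSL2Z) 
    (h0 : f (genC2C2C3 0) = S₀) (h1 : f (genC2C2C3 1) = S₁) (h2 : f (genC2C2C3 2) = R₂) :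
    (MonoidHom.range f).index = 4 := by
  have m0 : S₀ ∈ f.range := ⟨_, h0⟩
  have m1 : S₁ ∈ f.range := ⟨_, h1⟩
  have m2 : R₂ ∈ f.range := ⟨_, h2⟩
  have hT4 : fpeT ^ (4 : ℤ) ∈ f.range := by
    have : fpeT ^ (4 : ℤ) = S₁ * R₂ * S₀ := by rw [← fpe_T4]; norm_cast
    rw [this]; exact mul_mem (mul_mem m1 m2) m0
  have hb : Function.Bijective
      (fun k : Fin 4 => (QuotientGroup.mk (fpeT ^ ((k : ℕ) : ℤ)) : PSL2Z ⧸ f.range)) := by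
    constructor
    · intro i j hij
      have := QuotientGroup.eq.1 hij
      obtain ⟨x, hx⟩ := this
      have hm := fpe_range_sub f h0 h1 h2 x
      rw [hx, ← zpow_neg, ← zpow_add] at hm
      have := fpe_T_notMem _ hm
      ext; omega
    · intro q
      obtain ⟨g, rfl⟩ := QuotientGroup.mk_surjective q
      obtain ⟨n, h, hh, rfl⟩ := fpe_cover f.range m0 m1 m2 g
      refine ⟨⟨(n % 4).toNat, by omega⟩, ?_⟩
      apply QuotientGroup.eq.2
      have e : (((n % 4).toNat : ℕ) : ℤ) = n % 4 := by omega
      simp only [e]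
      rw [← mul_assoc, ← zpow_neg, ← zpow_add]
      refine mul_mem ?_ hh
      have : -(n % 4) + n = 4 * (n / 4) := by omega
      rw [this, zpow_mul]
      exact zpow_mem hT4 _
  rw [Subgroup.index, ← Nat.card_eq_of_bijective _ hb]
  simp

/-- homomorphism from a cyclic group -/
def fpeHom (n : ℕ) (g : PSL2Z) (h : g ^ n = 1) : Multiplicative (ZMod n) →* PSL2Z :=
  AddMonoidHom.toMultiplicativeLeft
    (ZMod.lift n ⟨zmultiplesHom (Additive PSL2Z) (Additive.ofMul g), by
      simp [← ofMul_pow, h]⟩)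

theorem fpeHom_one (n : ℕ) (g : PSL2Z) (h : g ^ n = 1) :
    fpeHom n g h (Multiplicative.ofAdd 1) = g := by
  have := ZMod.lift_coe n ⟨zmultiplesHom (Additive PSL2Z) (Additive.ofMul g), by
      simp [← ofMul_pow, h]⟩ 1
  simp only [Int.cast_one] at this
  simp [fpeHom, this]

theorem fpe_pow (i : Fin 3) : (![S₀, S₁, R₂] i) ^ (![2, 2, 3] i) = 1 := by
  fin_cases i
  · exact fpe_S0_sq
  · exact fpe_S1_sq
  · exact fpe_R2_cube

/-- `S₀` and `S₁` have order 2 and `R₂` has order 3 in `PSL₂(ℤ)`, and the homomorphism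
`C₂ * C₂ * C₃ → PSL₂(ℤ)` sending the two generators of order 2 to `S₀ = [S]` and
`S₁ = [T³ST⁻³]` and the generator of order 3 to `R₂ = [T²ST⁻¹]` exists, is injective, and
its image is a subgroup of `PSL₂(ℤ)` of index 4. -/
theorem free_product_embeds_index_four :
    orderOf S₀ = 2 ∧ orderOf S₁ = 2 ∧ orderOf R₂ = 3 ∧
    (∃ f : C2C2C3 →* PSL2Z,
      f (genC2C2C3 0) = S₀ ∧ f (genC2C2C3 1) = S₁ ∧ f (genC2C2C3 2) = R₂) ∧
    ∀ f : C2C2C3 →* PSL2Z,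
      f (genC2C2C3 0) = S₀ → f (genC2C2C3 1) = S₁ → f (genC2C2C3 2) = R₂ →
        Function.Injective f ∧ (MonoidHom.range f).index = 4 := by
  refine ⟨orderOf_eq_prime fpe_S0_sq fpe_S0_ne, orderOf_eq_prime fpe_S1_sq fpe_S1_ne,
    orderOf_eq_prime fpe_R2_cube fpe_R2_ne, ?_, fun f h0 h1 h2 =>
      ⟨fpe_inj f h0 h1 h2, fpe_index f h0 h1 h2⟩⟩
  refine ⟨Monoid.CoprodI.lift fun i => fpeHom (![2, 2, 3] i) (![S₀, S₁, R₂] i) (fpe_pow i), ?_, ?_, ?_⟩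
  all_goals
    unfold genC2C2C3
    rw [Monoid.CoprodI.lift_of, fpeHom_one]
    rfl
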